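/- For a, b > 0 let Λ(a,b) ⊂ ℝ³ be the lattice generated by (a, 0, 0), (0, b, 0) and (0, −b/2, b√3/2) (so that the last two generators form a hexagonal plane lattice with both generators of length b and angle 2π/3), and define, for t > 0, F_{a,b}(t) = ((a b² √3/6)/(4πt)^{3/2}) ∑_{v∈Λ(a,b)} e^{−‖v‖²/(4t)} + (a/√(πt)) ∑_{m∈ℤ} e^{−(m + 1/3)² a²/(4t)}. If a, b, a', b' > 0 satisfy F_{a,b}(t) = F_{a',b'}(t) for all t > 0, then a = a' and b = b'. -/

import Mathlib

open Real

/-- The lattice of the covering torus of `M₃`: generated by `(a,0,0)`, `(0,b,0)` and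
`(0,-b/2, b√3/2)` (the last two generators form a hexagonal plane lattice). -/
noncomputable def M3lattice (a b : ℝ) : Submodule ℤ (EuclideanSpace ℝ (Fin 3)) :=
  Submodule.span ℤ
    ({(WithLp.equiv 2 (Fin 3 → ℝ)).symm ![a, 0, 0],
      (WithLp.equiv 2 (Fin 3 → ℝ)).symm ![0, b, 0],
      (WithLp.equiv 2 (Fin 3 → ℝ)).symm ![0, -b/2, b * Real.sqrt 3 / 2]} :
      Set (EuclideanSpace ℝ (Fin 3)))

/-- The trace function `tr(H_{M₃})` of the flat 3-manifold `M₃` with parameters `a, b`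
(Theorem A), with `vol(M₃) = a b² √3/6`. -/
noncomputable def M3trace (a b t : ℝ) : ℝ :=
  (a * b ^ 2 * Real.sqrt 3 / 6) / (4 * π * t) ^ ((3:ℝ)/2) *
    (∑' v : M3lattice a b, Real.exp (-‖(v : EuclideanSpace ℝ (Fin 3))‖ ^ 2 / (4 * t))) +
  a / Real.sqrt (π * t) *
    (∑' m : ℤ, Real.exp (-((m : ℝ) + 1/3) ^ 2 * a ^ 2 / (4 * t)))

open Filter Topology

lemma summable_exp_neg_mul_int_sq {c : ℝ} (hc : 0 < c) :
    Summable fun m : ℤ => Real.exp (-(c * (m : ℝ) ^ 2)) := by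
  have key : Summable fun n : ℕ => Real.exp (-(c * (n : ℝ) ^ 2)) := by
    refine Summable.of_nonneg_of_le (fun _ => (Real.exp_pos _).le) (fun n => ?_)
      (Real.summable_exp_nat_mul_iff.2 (neg_lt_zero.2 hc))
    have h : (n : ℝ) ≤ (n : ℝ) ^ 2 := by exact_mod_cast Nat.le_self_pow two_ne_zero n
    exact Real.exp_le_exp.2 (by nlinarith)
  exact Summable.of_nat_of_neg (by simpa using key) (by simpa using key)

lemma summable_exp_neg_shifted_sq {a : ℝ} (ha : 0 < a) :
    Summable fun m : ℤ => Real.exp (-(((m : ℝ) + 1 / 3) ^ 2 * a ^ 2)) := by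
  refine Summable.of_nonneg_of_le (fun _ => (Real.exp_pos _).le) (fun m => ?_)
    (summable_exp_neg_mul_int_sq (c := a ^ 2 / 9) (by positivity))
  have h : (m : ℝ) ^ 2 ≤ (3 * m + 1) ^ 2 := by
    have : m ^ 2 ≤ (3 * m + 1) ^ 2 := by
      rcases le_or_gt 0 m with h | h <;> nlinarith
    exact_mod_cast this
  exact Real.exp_le_exp.2 (by nlinarith [mul_le_mul_of_nonneg_right h (sq_nonneg a)])

lemma one_ninth_le_shifted_sq (m : ℤ) : (1 / 9 : ℝ) ≤ ((m : ℝ) + 1 / 3) ^ 2 := by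
  have h : (1 : ℝ) ≤ (3 * m + 1) ^ 2 := by
    have : 1 ≤ (3 * m + 1) ^ 2 := by
      rcases le_or_gt 0 m with h | h <;> nlinarith
    exact_mod_cast this
  nlinarith

lemma exp_neg_mul_le {s x μ : ℝ} (hs : 1 ≤ s) (hx : μ ≤ x) :
    Real.exp (-(s * x)) ≤ Real.exp μ * Real.exp (-x) * Real.exp (-(s * μ)) := by
  rw [← Real.exp_add, ← Real.exp_add]
  exact Real.exp_le_exp.2 (by nlinarith [mul_nonneg (sub_nonneg.2 hs) (sub_nonneg.2 hx)])

/-- The theta series `∑ exp (-s (m + 1/3)² a²)`. -/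
noncomputable def shiftedTheta (a s : ℝ) : ℝ :=
  ∑' m : ℤ, Real.exp (-(s * (((m : ℝ) + 1 / 3) ^ 2 * a ^ 2)))

/-- The theta series of `M3lattice a b`. -/
noncomputable def latticeTheta (a b s : ℝ) : ℝ :=
  ∑' v : M3lattice a b, Real.exp (-(s * ‖(v : EuclideanSpace ℝ (Fin 3))‖ ^ 2))

lemma summable_shiftedTheta {a s : ℝ} (ha : 0 < a) (hs : 0 < s) :
    Summable fun m : ℤ => Real.exp (-(s * (((m : ℝ) + 1 / 3) ^ 2 * a ^ 2))) := by
  have h := summable_exp_neg_shifted_sq (a := √s * a) (by positivity)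
  refine h.congr fun m => ?_
  rw [mul_pow, Real.sq_sqrt hs.le]
  ring_nf

lemma exp_le_shiftedTheta {a s : ℝ} (ha : 0 < a) (hs : 0 < s) :
    Real.exp (-(s * (a ^ 2 / 9))) ≤ shiftedTheta a s := by
  refine le_trans (le_of_eq ?_)
    ((summable_shiftedTheta ha hs).le_tsum 0 fun _ _ => (Real.exp_pos _).le)
  rw [Int.cast_zero]
  congr 1
  ring

lemma exists_shiftedTheta_le {a : ℝ} (ha : 0 < a) :
    ∃ C, ∀ s, 1 ≤ s → shiftedTheta a s ≤ C * Real.exp (-(s * (a ^ 2 / 9))) := by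
  refine ⟨Real.exp (a ^ 2 / 9) * ∑' m : ℤ, Real.exp (-(((m : ℝ) + 1 / 3) ^ 2 * a ^ 2)),
    fun s hs => ?_⟩
  rw [← tsum_mul_left, ← tsum_mul_right]
  refine (summable_shiftedTheta ha (by linarith)).tsum_le_tsum (fun m => exp_neg_mul_le hs ?_)
    (((summable_exp_neg_shifted_sq ha).mul_left _).mul_right _)
  nlinarith [mul_le_mul_of_nonneg_right (one_ninth_le_shifted_sq m) (sq_nonneg a)]

lemma shiftedTheta_nonneg (a s : ℝ) : 0 ≤ shiftedTheta a s :=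
  tsum_nonneg fun _ => (Real.exp_pos _).le

lemma exists_int_coords {a b : ℝ} (v : M3lattice a b) :
    ∃ p : ℤ × ℤ × ℤ, (v : EuclideanSpace ℝ (Fin 3)) =
      !₂[p.1 * a, p.2.1 * b - p.2.2 * b / 2, p.2.2 * (b * √3 / 2)] := by
  obtain ⟨v, hv⟩ := v
  obtain ⟨k, l, m, h⟩ := Submodule.mem_span_triple.1 hv
  refine ⟨(k, l, m), ?_⟩
  dsimp only
  rw [← h]
  ext i
  fin_cases i <;> simp
  ring

lemma norm_sq_of_coords (a b x y z : ℝ) :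
    ‖(!₂[x * a, y * b - z * b / 2, z * (b * √3 / 2)] : EuclideanSpace ℝ (Fin 3))‖ ^ 2 =
      a ^ 2 * x ^ 2 + b ^ 2 * (y ^ 2 - y * z + z ^ 2) := by
  have h3 : (√3 : ℝ) ^ 2 = 3 := Real.sq_sqrt (by norm_num)
  rw [EuclideanSpace.norm_sq_eq]
  simp only [Fin.sum_univ_three, Real.norm_eq_abs, sq_abs]
  simp
  linear_combination (z ^ 2 * b ^ 2 / 4) * h3

lemma summable_exp_neg_norm_sq {a b : ℝ} (ha : 0 < a) (hb : 0 < b) :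
    Summable fun v : M3lattice a b => Real.exp (-‖(v : EuclideanSpace ℝ (Fin 3))‖ ^ 2) := by
  choose p hp using exists_int_coords (a := a) (b := b)
  have hinj : Function.Injective p := fun v w h => by
    ext1
    rw [hp v, hp w, h]
  have hb2 : 0 < b ^ 2 / 2 := by positivity
  have hsum := (summable_exp_neg_mul_int_sq (pow_pos ha 2)).mul_of_nonneg
    ((summable_exp_neg_mul_int_sq hb2).mul_of_nonneg (summable_exp_neg_mul_int_sq hb2)
      (fun _ => (Real.exp_pos _).le) fun _ => (Real.exp_pos _).le)
    (fun _ => (Real.exp_pos _).le) fun _ => mul_nonneg (Real.exp_pos _).le (Real.exp_pos _).le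
  refine Summable.of_nonneg_of_le (fun _ => (Real.exp_pos _).le) (fun v => ?_)
    (hsum.comp_injective hinj)
  simp only [Function.comp]
  rw [← Real.exp_add, ← Real.exp_add, hp v, norm_sq_of_coords]
  refine Real.exp_le_exp.2 ?_
  nlinarith [mul_nonneg hb2.le (sq_nonneg (((p v).2.1 : ℝ) - (p v).2.2))]

lemma min_sq_le_norm_sq {a b : ℝ} {v : M3lattice a b} (hv : v ≠ 0) :
    min (a ^ 2) (b ^ 2) ≤ ‖(v : EuclideanSpace ℝ (Fin 3))‖ ^ 2 := by
  obtain ⟨⟨x, y, z⟩, h⟩ := exists_int_coords v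
  rw [h, norm_sq_of_coords]
  dsimp only
  have hq : (0 : ℝ) ≤ (y : ℝ) ^ 2 - y * z + z ^ 2 := by
    nlinarith [sq_nonneg ((y : ℝ) - z), sq_nonneg (y : ℝ), sq_nonneg (z : ℝ)]
  by_cases hx : x = 0
  · by_cases hyz : y ^ 2 - y * z + z ^ 2 = 0
    · refine absurd (Subtype.ext ?_) hv
      have hz : z = 0 := by nlinarith [sq_nonneg (2 * y - z), sq_nonneg z]
      have hy : y = 0 := by nlinarith [sq_nonneg (2 * y - z), sq_nonneg z]
      rw [h]
      ext i
      fin_cases i <;> simp [hx, hy, hz]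
    · have h1 : (1 : ℝ) ≤ (y : ℝ) ^ 2 - y * z + z ^ 2 := by
        have h0 : 0 ≤ y ^ 2 - y * z + z ^ 2 := by exact_mod_cast hq
        have : 1 ≤ y ^ 2 - y * z + z ^ 2 := by omega
        exact_mod_cast this
      refine (min_le_right _ _).trans ?_
      nlinarith [mul_le_mul_of_nonneg_left h1 (sq_nonneg b),
        mul_nonneg (sq_nonneg a) (sq_nonneg (x : ℝ))]
  · have h1 : (1 : ℝ) ≤ (x : ℝ) ^ 2 := by
      have : 1 ≤ x ^ 2 := by
        have := sq_pos_of_ne_zero hx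
        omega
      exact_mod_cast this
    refine (min_le_left _ _).trans ?_
    nlinarith [mul_le_mul_of_nonneg_left h1 (sq_nonneg a), mul_nonneg (sq_nonneg b) hq]

lemma exp_neg_mul_norm_sq_le {a b s : ℝ} (hs : 1 ≤ s) (v : M3lattice a b) [Decidable (v = 0)] :
    Real.exp (-(s * ‖(v : EuclideanSpace ℝ (Fin 3))‖ ^ 2)) ≤
      (if v = 0 then 1 else 0) + Real.exp (min (a ^ 2) (b ^ 2)) *
        Real.exp (-‖(v : EuclideanSpace ℝ (Fin 3))‖ ^ 2) *
          Real.exp (-(s * min (a ^ 2) (b ^ 2))) := by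
  split_ifs with h
  · subst h
    simp
    positivity
  · rw [zero_add]
    exact exp_neg_mul_le hs (min_sq_le_norm_sq h)

lemma summable_exp_neg_mul_norm_sq {a b s : ℝ} (ha : 0 < a) (hb : 0 < b) (hs : 1 ≤ s) :
    Summable fun v : M3lattice a b =>
      Real.exp (-(s * ‖(v : EuclideanSpace ℝ (Fin 3))‖ ^ 2)) :=
  Summable.of_nonneg_of_le (fun _ => (Real.exp_pos _).le)
    (fun v => Real.exp_le_exp.2 (by nlinarith [sq_nonneg ‖(v : EuclideanSpace ℝ (Fin 3))‖]))
    (summable_exp_neg_norm_sq ha hb)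

lemma exists_latticeTheta_le {a b : ℝ} (ha : 0 < a) (hb : 0 < b) :
    ∃ C, ∀ s, 1 ≤ s → latticeTheta a b s ≤ 1 + C * Real.exp (-(s * min (a ^ 2) (b ^ 2))) := by
  classical
  refine ⟨Real.exp (min (a ^ 2) (b ^ 2)) * ∑' v : M3lattice a b,
    Real.exp (-‖(v : EuclideanSpace ℝ (Fin 3))‖ ^ 2), fun s hs => ?_⟩
  have h := (hasSum_ite_eq (0 : M3lattice a b) (1 : ℝ)).add
    (((summable_exp_neg_norm_sq ha hb).hasSum.mul_left
      (Real.exp (min (a ^ 2) (b ^ 2)))).mul_right (Real.exp (-(s * min (a ^ 2) (b ^ 2)))))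
  exact hasSum_le (fun v => exp_neg_mul_norm_sq_le hs v)
    (summable_exp_neg_mul_norm_sq ha hb hs).hasSum h

lemma one_add_exp_le_latticeTheta {a b s : ℝ} (ha : 0 < a) (hb : 0 < b) (hs : 1 ≤ s) :
    1 + Real.exp (-(s * b ^ 2)) ≤ latticeTheta a b s := by
  classical
  let w : M3lattice a b := ⟨_, Submodule.subset_span (Set.mem_insert_of_mem _
    (Set.mem_insert _ _))⟩
  have hw : ‖(w : EuclideanSpace ℝ (Fin 3))‖ ^ 2 = b ^ 2 := by
    rw [EuclideanSpace.norm_sq_eq]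
    simp [w, Fin.sum_univ_three]
  have hw0 : (0 : M3lattice a b) ≠ w := fun h => by
    rw [← h] at hw
    simp at hw
    exact (pow_pos hb 2).ne hw
  have h := (summable_exp_neg_mul_norm_sq ha hb hs).sum_le_tsum {0, w}
    fun _ _ => (Real.exp_pos _).le
  rw [Finset.sum_pair hw0, hw] at h
  simpa [latticeTheta] using h

lemma M3trace_mul {a b s : ℝ} (hs : 0 < s) :
    M3trace a b (1 / (4 * s)) * √(π / s) ^ 3 =
      a * b ^ 2 * √3 / 6 * latticeTheta a b s + 2 * π * a / s * shiftedTheta a s := by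
  have hr : 0 < √(π / s) := Real.sqrt_pos.2 (by positivity)
  have hr2 : √(π / s) ^ 2 = π / s := Real.sq_sqrt (by positivity)
  have h1 : (4 * π * (1 / (4 * s))) ^ ((3 : ℝ) / 2) = √(π / s) ^ 3 := by
    rw [Real.sqrt_eq_rpow, ← Real.rpow_natCast, ← Real.rpow_mul (by positivity)]
    congr 1
    · field_simp
    · norm_num
  have h2 : √(π * (1 / (4 * s))) = √(π / s) / 2 := by
    rw [show π * (1 / (4 * s)) = (√(π / s) / 2) ^ 2 by rw [div_pow, hr2]; field_simp; norm_num]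
    exact Real.sqrt_sq (by positivity)
  have h3 : ∀ x : ℝ, -x / (4 * (1 / (4 * s))) = -(s * x) := fun x => by field_simp
  have h4 : ∀ m : ℤ, -((m : ℝ) + 1 / 3) ^ 2 * a ^ 2 = -(((m : ℝ) + 1 / 3) ^ 2 * a ^ 2) :=
    fun m => neg_mul _ _
  rw [M3trace, h1, h2]
  simp only [h4, h3]
  change (_ / _ * latticeTheta a b s + _ * shiftedTheta a s) * _ = _
  rw [show 2 * π * a / s = 2 * a * √(π / s) ^ 2 by rw [hr2]; ring]
  field_simp

lemma tendsto_exp_neg_mul {δ : ℝ} (hδ : 0 < δ) :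
    Tendsto (fun s : ℝ => Real.exp (-(s * δ))) atTop (𝓝 0) :=
  Real.tendsto_exp_neg_atTop_nhds_zero.comp (tendsto_id.atTop_mul_const hδ)

lemma tendsto_mul_exp_neg_mul {δ : ℝ} (hδ : 0 < δ) :
    Tendsto (fun s : ℝ => s * Real.exp (-(s * δ))) atTop (𝓝 0) := by
  simpa [mul_comm] using tendsto_rpow_mul_exp_neg_mul_atTop_nhds_zero 1 δ hδ

lemma tendsto_trace_main {a b : ℝ} (ha : 0 < a) (hb : 0 < b) (V : ℝ) :
    Tendsto (fun s => V * latticeTheta a b s + 2 * π * a / s * shiftedTheta a s)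
      atTop (𝓝 V) := by
  obtain ⟨C, hC⟩ := exists_latticeTheta_le ha hb
  obtain ⟨D, hD⟩ := exists_shiftedTheta_le ha
  have hL : Tendsto (latticeTheta a b) atTop (𝓝 1) := by
    refine tendsto_of_tendsto_of_tendsto_of_le_of_le' tendsto_const_nhds
      (h := fun s => 1 + C * Real.exp (-(s * min (a ^ 2) (b ^ 2)))) ?_ ?_ ?_
    · simpa using ((tendsto_exp_neg_mul (δ := min (a ^ 2) (b ^ 2)) (by positivity)).const_mul
        C).const_add 1
    · filter_upwards [eventually_ge_atTop 1] with s hs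
      linarith [one_add_exp_le_latticeTheta ha hb hs, Real.exp_pos (-(s * b ^ 2))]
    · filter_upwards [eventually_ge_atTop 1] with s hs using hC s hs
  have hS : Tendsto (shiftedTheta a) atTop (𝓝 0) := by
    refine tendsto_of_tendsto_of_tendsto_of_le_of_le' tendsto_const_nhds
      (h := fun s => D * Real.exp (-(s * (a ^ 2 / 9)))) ?_
      (Eventually.of_forall (shiftedTheta_nonneg a)) ?_
    · simpa using (tendsto_exp_neg_mul (δ := a ^ 2 / 9) (by positivity)).const_mul D
    · filter_upwards [eventually_ge_atTop 1] with s hs using hD s hs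
  simpa using (hL.const_mul V).add ((tendsto_id.const_div_atTop (2 * π * a)).mul hS)

lemma not_lt_of_theta_identity {a b a' b' V : ℝ} (ha : 0 < a) (hb : 0 < b) (ha' : 0 < a')
    (hb' : 0 < b') (hV : 0 < V) (hbb : b' < b)
    (h : ∀ s, 0 < s → V * latticeTheta a b s + 2 * π * a / s * shiftedTheta a s =
      V * latticeTheta a' b' s + 2 * π * a' / s * shiftedTheta a' s) : ¬ a < a' := by
  intro haa
  have hsq : a ^ 2 < a' ^ 2 := by gcongr
  have hbsq : b' ^ 2 < b ^ 2 := by gcongr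
  have ha2 : 0 < a ^ 2 := by positivity
  rcases le_or_gt (b' ^ 2) (a ^ 2 / 9) with hc | hc
  · obtain ⟨C, hC⟩ := exists_latticeTheta_le ha hb
    obtain ⟨D, hD⟩ := exists_shiftedTheta_le ha
    have hμ : 0 < min (a ^ 2) (b ^ 2) - b' ^ 2 := sub_pos.2 (lt_min (by linarith) hbsq)
    have hlim : Tendsto (fun s : ℝ => V * C * Real.exp (-(s * (min (a ^ 2) (b ^ 2) - b' ^ 2))) +
        2 * π * a * D / s) atTop (𝓝 0) := by
      simpa using ((tendsto_exp_neg_mul hμ).const_mul (V * C)).add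
        (tendsto_id.const_div_atTop (2 * π * a * D))
    refine hV.not_ge (ge_of_tendsto hlim ?_)
    filter_upwards [eventually_ge_atTop 1] with s hs
    have hs0 : 0 < s := by linarith
    have hD0 : 0 ≤ D := by
      have := (shiftedTheta_nonneg a 1).trans (hD 1 le_rfl)
      exact nonneg_of_mul_nonneg_left this (Real.exp_pos _)
    have e1 : Real.exp (-(s * min (a ^ 2) (b ^ 2))) =
        Real.exp (-(s * (min (a ^ 2) (b ^ 2) - b' ^ 2))) * Real.exp (-(s * b' ^ 2)) := by
      rw [← Real.exp_add]; ring_nf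
    have e2 : Real.exp (-(s * (a ^ 2 / 9))) ≤ Real.exp (-(s * b' ^ 2)) :=
      Real.exp_le_exp.2 (neg_le_neg (by gcongr))
    have l1 := mul_le_mul_of_nonneg_left (one_add_exp_le_latticeTheta ha' hb' hs) hV.le
    have l2 := mul_le_mul_of_nonneg_left (hC s hs) hV.le
    have l3 := mul_le_mul_of_nonneg_left ((hD s hs).trans (mul_le_mul_of_nonneg_left e2 hD0))
      (show 0 ≤ 2 * π * a / s by positivity)
    have l4 := mul_nonneg (show 0 ≤ 2 * π * a' / s by positivity) (shiftedTheta_nonneg a' s)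
    rw [e1] at l2
    refine le_of_mul_le_mul_right ?_ (Real.exp_pos (-(s * b' ^ 2)))
    rw [show 2 * π * a * D / s = 2 * π * a / s * D by ring]
    linarith [h s hs0]
  · obtain ⟨C, hC⟩ := exists_latticeTheta_le ha' hb'
    obtain ⟨D, hD⟩ := exists_shiftedTheta_le ha'
    have hμ : 0 < min (a' ^ 2) (b' ^ 2) - a ^ 2 / 9 := sub_pos.2 (lt_min (by linarith) hc)
    have hν : 0 < a' ^ 2 / 9 - a ^ 2 / 9 := by linarith
    have hlim : Tendsto (fun s : ℝ =>
        V * C * (s * Real.exp (-(s * (min (a' ^ 2) (b' ^ 2) - a ^ 2 / 9)))) +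
        2 * π * a' * D * Real.exp (-(s * (a' ^ 2 / 9 - a ^ 2 / 9)))) atTop (𝓝 0) := by
      simpa using ((tendsto_mul_exp_neg_mul hμ).const_mul (V * C)).add
        ((tendsto_exp_neg_mul hν).const_mul (2 * π * a' * D))
    refine (show 0 < 2 * π * a by positivity).not_ge (ge_of_tendsto hlim ?_)
    filter_upwards [eventually_ge_atTop 1] with s hs
    have hs0 : 0 < s := by linarith
    have e1 : Real.exp (-(s * min (a' ^ 2) (b' ^ 2))) =
        Real.exp (-(s * (min (a' ^ 2) (b' ^ 2) - a ^ 2 / 9))) * Real.exp (-(s * (a ^ 2 / 9))) := by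
      rw [← Real.exp_add]; ring_nf
    have e2 : Real.exp (-(s * (a' ^ 2 / 9))) =
        Real.exp (-(s * (a' ^ 2 / 9 - a ^ 2 / 9))) * Real.exp (-(s * (a ^ 2 / 9))) := by
      rw [← Real.exp_add]; ring_nf
    have l1 := mul_le_mul_of_nonneg_left ((le_add_of_nonneg_right (Real.exp_pos _).le).trans
      (one_add_exp_le_latticeTheta ha hb hs)) hV.le
    have l2 := mul_le_mul_of_nonneg_left (hC s hs) hV.le
    have l3 := mul_le_mul_of_nonneg_left (hD s hs) (show 0 ≤ 2 * π * a' / s by positivity)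
    have l4 := mul_le_mul_of_nonneg_left (exp_le_shiftedTheta ha hs0)
      (show 0 ≤ 2 * π * a / s by positivity)
    rw [e1] at l2
    rw [e2] at l3
    refine le_of_mul_le_mul_right ?_ (mul_pos (inv_pos.2 hs0) (Real.exp_pos (-(s * (a ^ 2 / 9)))))
    have hs1 : s * s⁻¹ = 1 := mul_inv_cancel₀ hs0.ne'
    have := h s hs0
    simp only [div_eq_mul_inv _ s] at l3 l4 this
    calc _ ≤ V * (C * (Real.exp (-(s * (min (a' ^ 2) (b' ^ 2) - a ^ 2 / 9))) *
              Real.exp (-(s * (a ^ 2 / 9))))) +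
            2 * π * a' * s⁻¹ * (D * (Real.exp (-(s * (a' ^ 2 / 9 - a ^ 2 / 9))) *
              Real.exp (-(s * (a ^ 2 / 9))))) := by linarith
      _ = _ := by
        linear_combination -(V * C * Real.exp (-(s * (min (a' ^ 2) (b' ^ 2) - a ^ 2 / 9))) *
          Real.exp (-(s * (a ^ 2 / 9)))) * hs1

/-- Case `M₃` of Theorem B: two flat 3-manifolds of type `M₃` with equal trace functions
have the same parameters. -/
theorem M3_isospectral_implies_isometric
    (a b a' b' : ℝ) (ha : 0 < a) (hb : 0 < b) (ha' : 0 < a') (hb' : 0 < b')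
    (heq : ∀ t : ℝ, 0 < t → M3trace a b t = M3trace a' b' t) :
    a = a' ∧ b = b' := by
  have h : ∀ s, 0 < s →
      a * b ^ 2 * √3 / 6 * latticeTheta a b s + 2 * π * a / s * shiftedTheta a s =
      a' * b' ^ 2 * √3 / 6 * latticeTheta a' b' s + 2 * π * a' / s * shiftedTheta a' s :=
    fun s hs => by rw [← M3trace_mul hs, ← M3trace_mul hs, heq _ (by positivity)]
  have hV : a * b ^ 2 * √3 / 6 = a' * b' ^ 2 * √3 / 6 :=
    tendsto_nhds_unique (tendsto_trace_main ha hb _) ((tendsto_trace_main ha' hb' _).congr' (by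
      filter_upwards [eventually_gt_atTop 0] with s hs using (h s hs).symm))
  have hvol : a * b ^ 2 = a' * b' ^ 2 := by
    have h3 : (0 : ℝ) < √3 := by positivity
    exact mul_right_cancel₀ h3.ne' (by linarith)
  have hpos : 0 < a * b ^ 2 * √3 / 6 := by positivity
  rw [← hV] at h
  rcases lt_trichotomy a a' with haa | rfl | haa
  · refine absurd haa (not_lt_of_theta_identity ha hb ha' hb' hpos ?_ h)
    by_contra! hbb
    have : b ^ 2 ≤ b' ^ 2 := by gcongr
    nlinarith [pow_pos hb 2]
  · exact ⟨rfl, (pow_left_inj₀ hb.le hb'.le two_ne_zero).1 (mul_left_cancel₀ ha.ne' hvol)⟩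
  · refine absurd haa (not_lt_of_theta_identity ha' hb' ha hb hpos ?_ fun s hs => (h s hs).symm)
    by_contra! hbb
    have : b' ^ 2 ≤ b ^ 2 := by gcongr
    nlinarith [pow_pos hb' 2]
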